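/- For every integer n >= 9, L_n = SP: a real 2d-by-2d matrix is symplectic if and only if it is an alternating product of n unit upper and lower triangular symplectic matrices with symmetric blocks. -/

import Mathlib

open Matrix

/-- The standard symplectic matrix `J = [[0, I], [-I, 0]]` of size `2d`. -/
def Jmat (d : ℕ) : Matrix (Fin d ⊕ Fin d) (Fin d ⊕ Fin d) ℝ :=
  Matrix.fromBlocks 0 1 (-1) 0

/-- The `i`-th unit triangular symplectic factor: `[[I, S],[0, I]]` for odd `i`
and `[[I, 0],[S, I]]` for even `i`. -/
def Pfac (d : ℕ) (i : ℕ) (S : Matrix (Fin d) (Fin d) ℝ) :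
    Matrix (Fin d ⊕ Fin d) (Fin d ⊕ Fin d) ℝ :=
  if i % 2 = 1 then Matrix.fromBlocks 1 S 0 1 else Matrix.fromBlocks 1 0 S 1

/-- The alternating product `Pₙ ⋯ P₂ P₁` of unit triangular symplectic factors
(with `Pᵢ` built from `S i`). -/
def altProd (d : ℕ) :
    ℕ → (ℕ → Matrix (Fin d) (Fin d) ℝ) → Matrix (Fin d ⊕ Fin d) (Fin d ⊕ Fin d) ℝ
  | 0, _ => 1
  | n + 1, S => Pfac d (n + 1) (S (n + 1)) * altProd d n S

open Polynomial in
/-- For `I ≠ ⊥`, the quotient `K[X] ⧸ I` carries a linear functional whose kernel contains no nonzero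
ideal. -/
theorem exists_functional_quotient_mul_ne_zero {K : Type*} [Field K] (I : Ideal K[X])
    (hI : I ≠ ⊥) :
    ∃ φ : (K[X] ⧸ I) →ₗ[K] K, ∀ x ≠ 0, ∃ y, φ (x * y) ≠ 0 := by
  obtain ⟨g, hg, rfl⟩ : ∃ g : K[X], g.Monic ∧ I = Ideal.span {g} := by
    obtain ⟨f, rfl⟩ := (IsPrincipalIdealRing.principal I).principal
    have hf : f ≠ 0 := by
      rintro rfl
      simp at hI
    refine ⟨f * C f.leadingCoeff⁻¹, monic_mul_leadingCoeff_inv hf, ?_⟩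
    refine (Ideal.span_singleton_mul_right_unit ?_ f).symm
    exact isUnit_C.2 (by simpa using hf)
  let φ : AdjoinRoot g →ₗ[K] K := lcoeff K (g.natDegree - 1) ∘ₗ AdjoinRoot.modByMonicHom hg
  refine ⟨φ, fun x hx ↦ ?_⟩
  obtain ⟨p, rfl⟩ := AdjoinRoot.mk_surjective (g := g) x
  have hgp : AdjoinRoot.mk g p = AdjoinRoot.mk g (p %ₘ g) := by
    rw [AdjoinRoot.mk_eq_mk, modByMonic_eq_sub_mul_div, sub_sub_cancel]
    exact dvd_mul_right _ _
  set r := p %ₘ g with hr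
  have hr0 : r ≠ 0 := by
    intro h
    rw [h, map_zero] at hgp
    exact hx hgp
  have hg1 : g ≠ 1 := by
    rintro rfl
    exact hr0 (by simp [hr])
  have hdeg : r.natDegree < g.natDegree := natDegree_modByMonic_lt p hg hg1
  refine ⟨AdjoinRoot.mk g (X ^ (g.natDegree - 1 - r.natDegree)), ?_⟩
  have hdeg' : (r * X ^ (g.natDegree - 1 - r.natDegree)).natDegree = g.natDegree - 1 := by
    rw [natDegree_mul_X_pow _ hr0]
    omega
  have key : φ (AdjoinRoot.mk g p * AdjoinRoot.mk g (X ^ (g.natDegree - 1 - r.natDegree)))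
      = r.leadingCoeff := by
    rw [hgp, ← map_mul]
    simp only [φ, LinearMap.comp_apply, AdjoinRoot.modByMonicHom_mk, lcoeff_apply]
    rw [(modByMonic_eq_self_iff hg).2]
    · conv_lhs => arg 2; rw [← hdeg']
      rw [coeff_natDegree, leadingCoeff_mul_X_pow]
    · exact degree_lt_degree (by omega)
  exact key ▸ leadingCoeff_ne_zero.2 hr0

open Polynomial Module in
/-- Every endomorphism of a finite-dimensional space is self-adjoint for some nondegenerate
symmetric bilinear form. -/
theorem exists_symm_form_selfAdjoint {K V : Type*} [Field K] [AddCommGroup V] [Module K V]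
    [FiniteDimensional K V] (f : V →ₗ[K] V) :
    ∃ b : V → V → K, (∀ u v, b u v = b v u) ∧ (∀ u v w, b u (v + w) = b u v + b u w) ∧
      (∀ c u v, b u (c • v) = c * b u v) ∧ (∀ u v, b (f u) v = b u (f v)) ∧
      ∀ v ≠ 0, ∃ u, b u v ≠ 0 := by
  classical
  have htor : Module.IsTorsion K[X] (AEval' f) := AEval.isTorsion_of_finiteDimensional K V f
  obtain ⟨ι, _, p, hp, k, ⟨e⟩⟩ := Module.equiv_directSum_of_isTorsion htor
  choose φ hφ using fun i ↦ exists_functional_quotient_mul_ne_zero (Ideal.span {p i ^ k i})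
    (by simpa using fun h ↦ absurd h (hp i).ne_zero)
  let E : V → ∀ i, K[X] ⧸ Ideal.span {p i ^ k i} := fun v i ↦ e (AEval'.of f v) i
  have E_add (u v) (i) : E (u + v) i = E u i + E v i := by simp [E]
  have E_smul (c : K) (v) (i) : E (c • v) i = c • E v i := by
    have : AEval'.of f (c • v) = (C c : K[X]) • AEval'.of f v := by simp
    simp only [E, this, map_smul, DirectSum.smul_apply]
    rw [← algebraMap_smul K[X] c]
    rfl
  have E_f (v) (i) : E (f v) i = (X : K[X]) • E v i := by
    simp only [E, ← AEval'.X_smul_of, map_smul, DirectSum.smul_apply]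
  refine ⟨fun u v ↦ ∑ i, φ i (E u i * E v i), ?_, ?_, ?_, ?_, ?_⟩
  · intro u v
    simp only [mul_comm]
  · intro u v w
    simp only [E_add, mul_add, map_add, Finset.sum_add_distrib]
  · intro c u v
    simp only [E_smul, mul_smul_comm, map_smul, smul_eq_mul, Finset.mul_sum]
  · intro u v
    simp only [E_f, mul_smul_comm, smul_mul_assoc]
  · intro v hv
    obtain ⟨i, hi⟩ : ∃ i, E v i ≠ 0 := by
      by_contra! h
      apply hv
      have : e (AEval'.of f v) = 0 := DFinsupp.ext h
      simpa using this
    obtain ⟨y, hy⟩ := hφ i _ hi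
    refine ⟨(AEval'.of f).symm (e.symm (DirectSum.lof K[X] ι
      (fun i ↦ K[X] ⧸ Ideal.span {p i ^ k i}) i y)), ?_⟩
    have hE : E ((AEval'.of f).symm (e.symm (DirectSum.lof K[X] ι
        (fun i ↦ K[X] ⧸ Ideal.span {p i ^ k i}) i y))) = Pi.single i y := by
      funext j
      simp only [E, LinearEquiv.apply_symm_apply]
      rcases eq_or_ne i j with rfl | hij
      · rw [Pi.single_eq_same]
        exact DirectSum.lof_apply _ _ _
      · rw [Pi.single_eq_of_ne hij.symm]
        exact DirectSum.of_eq_of_ne _ _ _ hij.symm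
    beta_reduce
    rw [hE, Finset.sum_eq_single i, Pi.single_eq_same, mul_comm]
    · exact hy
    · intro j _ hj
      simp [Pi.single_eq_of_ne hj]
    · simp

/-- Frobenius: every square matrix over a field is a product of two symmetric matrices, the first
of which can be taken invertible. -/
theorem exists_eq_mul_isSymm {K m : Type*} [Field K] [Fintype m] [DecidableEq m]
    (A : Matrix m m K) :
    ∃ S R : Matrix m m K, S.IsSymm ∧ R.IsSymm ∧ IsUnit S.det ∧ A = S * R := by
  obtain ⟨b, hsymm, hadd, hsmul, hadj, hnd⟩ := exists_symm_form_selfAdjoint (Matrix.toLin' A)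
  let B (u : m → K) : (m → K) →ₗ[K] K := ⟨⟨b u, hadd u⟩, fun c v ↦ hsmul c u v⟩
  let G : Matrix m m K := Matrix.of fun i j ↦ b (Pi.single i 1) (Pi.single j 1)
  have hG : G.IsSymm := by
    ext i j
    exact hsymm _ _
  have hGv (v : m → K) (i : m) : (G *ᵥ v) i = b (Pi.single i 1) v := by
    change _ = B (Pi.single i 1) v
    conv_rhs => rw [pi_eq_sum_univ' v, map_sum]
    simp only [map_smul, smul_eq_mul, Matrix.mulVec, dotProduct, G, Matrix.of_apply, B]
    refine Finset.sum_congr rfl fun j _ ↦ ?_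
    rw [mul_comm]
    congr 2
  have hGA : (G * A).IsSymm := by
    have hentry (i j) : (G * A) i j = b (Pi.single i 1) (Matrix.toLin' A (Pi.single j 1)) := by
      rw [← hGv, Matrix.toLin'_apply, Matrix.mulVec_mulVec]
      simp
    ext i j
    rw [Matrix.transpose_apply, hentry, hentry, ← hadj, hsymm]
  have hdet : IsUnit G.det := by
    rw [isUnit_iff_ne_zero]
    intro h
    obtain ⟨v, hv, hGv0⟩ := Matrix.exists_mulVec_eq_zero_iff.2 h
    obtain ⟨u, hu⟩ := hnd v hv
    apply hu
    rw [hsymm]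
    change B v u = 0
    rw [pi_eq_sum_univ' u, map_sum]
    refine Finset.sum_eq_zero fun i _ ↦ ?_
    have := congrFun hGv0 i
    rw [hGv, hsymm] at this
    rw [map_smul]
    refine smul_eq_zero_of_right _ ?_
    exact this
  refine ⟨G⁻¹, G * A, ?_, hGA, Matrix.isUnit_nonsing_inv_det G hdet, ?_⟩
  · rw [Matrix.IsSymm, Matrix.transpose_nonsing_inv, hG.eq]
  · rw [Matrix.nonsing_inv_mul_cancel_left _ _ hdet]

open Polynomial in
/-- If `AᵀC` is symmetric and `A`, `C` have no common kernel, then some matrix of the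
pencil `A + tC` is invertible: `A + iC` is, since `(A + iC)ᴴ(A + iC) = AᵀA + CᵀC`. -/
theorem exists_isUnit_det_add_smul {m : Type*} [Fintype m] [DecidableEq m]
    {A C : Matrix m m ℝ} (hAC : Aᵀ * C = Cᵀ * A)
    (hker : ∀ v : m → ℝ, A *ᵥ v = 0 → C *ᵥ v = 0 → v = 0) :
    ∃ t : ℝ, IsUnit (A + t • C).det := by
  have hgram : (Aᵀ * A + Cᵀ * C).det ≠ 0 := by
    intro h
    obtain ⟨v, hv, h0⟩ := Matrix.exists_mulVec_eq_zero_iff.2 h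
    have hsum : (A *ᵥ v) ⬝ᵥ (A *ᵥ v) + (C *ᵥ v) ⬝ᵥ (C *ᵥ v) = 0 := by
      have := congrArg (v ⬝ᵥ ·) h0
      simpa [Matrix.add_mulVec, ← Matrix.mulVec_mulVec, Matrix.dotProduct_mulVec,
        Matrix.vecMul_transpose] using this
    have hnonneg (w : m → ℝ) : 0 ≤ w ⬝ᵥ w := Finset.sum_nonneg fun i _ ↦ mul_self_nonneg (w i)
    have hA := hnonneg (A *ᵥ v)
    have hC := hnonneg (C *ᵥ v)
    exact hv (hker v (dotProduct_self_eq_zero.1 (by linarith))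
      (dotProduct_self_eq_zero.1 (by linarith)))
  let q : ℝ[X] := (A.map Polynomial.C + (X : ℝ[X]) • C.map Polynomial.C).det
  have hqI : aeval Complex.I q =
      (A.map Complex.ofRealHom + Complex.I • C.map Complex.ofRealHom).det := by
    simp only [q, AlgHom.map_det]
    congr 1
    ext i j
    simpa using mul_comm _ _
  have hq : q ≠ 0 := by
    intro h0
    rw [h0, map_zero] at hqI
    have hmul : ((A.map Complex.ofRealHom)ᵀ - Complex.I • (C.map Complex.ofRealHom)ᵀ) *
        (A.map Complex.ofRealHom + Complex.I • C.map Complex.ofRealHom) =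
        (Aᵀ * A + Cᵀ * C).map Complex.ofRealHom := by
      have hAC' : Aᵀ.map Complex.ofRealHom * C.map Complex.ofRealHom =
          Cᵀ.map Complex.ofRealHom * A.map Complex.ofRealHom := by
        rw [← Matrix.map_mul, hAC, Matrix.map_mul]
      rw [Matrix.map_add _ (map_add _), Matrix.map_mul, Matrix.map_mul]
      simp only [sub_mul, mul_add, Matrix.smul_mul, Matrix.mul_smul, ← Matrix.transpose_map, hAC',
        smul_smul, Complex.I_mul_I, neg_smul, one_smul]
      abel
    have hdet := congrArg Matrix.det hmul
    rw [Matrix.det_mul, ← hqI, mul_zero] at hdet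
    have hmap := RingHom.map_det Complex.ofRealHom (Aᵀ * A + Cᵀ * C)
    rw [RingHom.mapMatrix_apply, ← hdet] at hmap
    exact hgram (by simpa using hmap)
  obtain ⟨t, ht⟩ : ∃ t, q.eval t ≠ 0 := by
    by_contra! h
    exact hq (Polynomial.funext fun t ↦ by simpa using h t)
  refine ⟨t, isUnit_iff_ne_zero.2 fun h ↦ ht ?_⟩
  rw [← h, ← coe_evalRingHom, RingHom.map_det]
  congr 1
  ext i j
  simpa using mul_comm _ _

section Factorization

variable {m K : Type*} [Fintype m] [DecidableEq m] [Field K]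

/-- `diag(SR, (RS)⁻¹)` is a product of five unit triangular symplectic matrices when `S` and `R`
are invertible. -/
theorem fromBlocks_diagonal_eq_triangular_prod {S R : Matrix m m K} (hS : IsUnit S.det)
    (hR : IsUnit R.det) :
    fromBlocks (S * R) 0 0 (S⁻¹ * R⁻¹) =
      fromBlocks 1 S 0 1 * (fromBlocks 1 0 (-S⁻¹) 1 * (fromBlocks 1 (S - R⁻¹) 0 1 *
        (fromBlocks 1 0 R 1 * fromBlocks 1 (-R⁻¹) 0 1))) := by
  simp [fromBlocks_multiply, sub_mul, ← mul_assoc,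
    Matrix.mul_nonsing_inv _ hS, Matrix.nonsing_inv_mul _ hS, Matrix.mul_nonsing_inv _ hR,
    Matrix.nonsing_inv_mul _ hR]

/-- Block `LDU` factorization of a symplectic matrix whose upper-left block is invertible. -/
theorem fromBlocks_symplectic_eq_LDU {A B C D : Matrix m m K} (hA : IsUnit A.det)
    (hAC : Aᵀ * C = Cᵀ * A) (hAD : Aᵀ * D - Cᵀ * B = 1) :
    fromBlocks A B C D =
      fromBlocks 1 0 (C * A⁻¹) 1 * (fromBlocks A 0 0 Aᵀ⁻¹ * fromBlocks 1 (A⁻¹ * B) 0 1) := by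
  have hAT : IsUnit Aᵀ.det := by rwa [Matrix.det_transpose]
  have hD : D = C * A⁻¹ * B + Aᵀ⁻¹ := by
    have h1 : Aᵀ * D = Aᵀ * (C * A⁻¹ * B + Aᵀ⁻¹) := by
      rw [mul_add, Matrix.mul_nonsing_inv _ hAT, ← mul_assoc, ← mul_assoc, hAC,
        Matrix.mul_nonsing_inv_cancel_right _ _ hA, add_comm]
      exact sub_eq_iff_eq_add.1 hAD
    rw [← Matrix.nonsing_inv_mul_cancel_left _ D hAT, h1,
      Matrix.nonsing_inv_mul_cancel_left _ _ hAT]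
  simp [fromBlocks_multiply, Matrix.mul_nonsing_inv_cancel_left _ _ hA,
    Matrix.nonsing_inv_mul_cancel_right _ _ hA, ← hD, ← mul_assoc]

end Factorization

theorem mem_symplecticGroup_iff_Jmat {d : ℕ} {H : Matrix (Fin d ⊕ Fin d) (Fin d ⊕ Fin d) ℝ} :
    H ∈ symplecticGroup (Fin d) ℝ ↔ Hᵀ * Jmat d * H = Jmat d := by
  have hJ : Jmat d = -Matrix.J (Fin d) ℝ := by simp [Jmat, Matrix.J, fromBlocks_neg]
  rw [SymplecticGroup.mem_iff', hJ]
  simp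

theorem fromBlocks_upper_mem_symplecticGroup {m R : Type*} [Fintype m] [DecidableEq m]
    [CommRing R] {S : Matrix m m R} (hS : Sᵀ = S) :
    fromBlocks 1 S 0 1 ∈ symplecticGroup m R := by
  simp [SymplecticGroup.fromBlocks_mem_iff, hS]

theorem altProd_mem_symplecticGroup {d : ℕ} {S : ℕ → Matrix (Fin d) (Fin d) ℝ}
    (hS : ∀ i, (S i)ᵀ = S i) (n : ℕ) : altProd d n S ∈ symplecticGroup (Fin d) ℝ := by
  induction n with
  | zero => exact one_mem _
  | succ n ih =>
    refine mul_mem ?_ ih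
    unfold Pfac
    split_ifs
    · exact fromBlocks_upper_mem_symplecticGroup (hS _)
    · simp [SymplecticGroup.fromBlocks_mem_iff, hS]

theorem altProd_eq_of_eq_zero {d k n : ℕ} (hkn : k ≤ n) {S : ℕ → Matrix (Fin d) (Fin d) ℝ}
    (hS : ∀ i, k < i → S i = 0) : altProd d n S = altProd d k S := by
  induction n, hkn using Nat.le_induction with
  | base => rfl
  | succ n hn ih => simp [altProd, Pfac, hS (n + 1) (by omega), ih]

/-- Seven alternating factors already suffice for every symplectic matrix. -/
theorem exists_eq_altProd_seven {d : ℕ} {H : Matrix (Fin d ⊕ Fin d) (Fin d ⊕ Fin d) ℝ}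
    (hH : H ∈ symplecticGroup (Fin d) ℝ) :
    ∃ S : ℕ → Matrix (Fin d) (Fin d) ℝ,
      (∀ i, (S i)ᵀ = S i) ∧ (∀ i, 7 < i → S i = 0) ∧ H = altProd d 7 S := by
  obtain ⟨A₀, B₀, C, D, rfl⟩ : ∃ A B C D, H = fromBlocks A B C D :=
    ⟨_, _, _, _, (fromBlocks_toBlocks H).symm⟩
  obtain ⟨h1, -, h3⟩ := SymplecticGroup.fromBlocks_mem_iff.1 hH
  obtain ⟨t, ht⟩ := exists_isUnit_det_add_smul h1 fun v hA hC ↦ by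
    have h3' := congrArg transpose h3
    simp only [transpose_sub, transpose_mul, transpose_transpose, transpose_one] at h3'
    rw [← one_mulVec v, ← h3', sub_mulVec, ← mulVec_mulVec, ← mulVec_mulVec, hA, hC]
    simp
  set A := A₀ + t • C with hAdef
  set B := B₀ + t • D with hBdef
  have hshift : fromBlocks 1 (t • 1) 0 1 * fromBlocks A₀ B₀ C D = fromBlocks A B C D := by
    simp [fromBlocks_multiply, hAdef, hBdef]
  have hunshift : fromBlocks A₀ B₀ C D = fromBlocks 1 (-(t • 1)) 0 1 * fromBlocks A B C D := by
    simp [fromBlocks_multiply, hAdef, hBdef]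
  have hmem : fromBlocks A B C D ∈ symplecticGroup (Fin d) ℝ :=
    hshift ▸ mul_mem (fromBlocks_upper_mem_symplecticGroup (by simp)) hH
  obtain ⟨hAC, -, hAD⟩ := SymplecticGroup.fromBlocks_mem_iff.1 hmem
  have hAB : A * Bᵀ = B * Aᵀ := by
    have := SymplecticGroup.transpose_mem hmem
    rw [fromBlocks_transpose, SymplecticGroup.fromBlocks_mem_iff] at this
    simpa using this.1
  obtain ⟨S, R, hS, hR, hSdet, hSR⟩ := exists_eq_mul_isSymm A
  have hRdet : IsUnit R.det := by
    rw [hSR, det_mul] at ht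
    exact isUnit_of_mul_isUnit_right ht
  have hAT : IsUnit Aᵀ.det := by rwa [det_transpose]
  have hATinv : Aᵀ⁻¹ = S⁻¹ * R⁻¹ := by
    rw [hSR, transpose_mul, hS.eq, hR.eq, Matrix.mul_inv_rev]
  have hCA : (C * A⁻¹)ᵀ = C * A⁻¹ := by
    rw [transpose_mul, transpose_nonsing_inv, ← nonsing_inv_mul_cancel_left _ (C * A⁻¹) hAT,
      ← mul_assoc Aᵀ, hAC, mul_nonsing_inv_cancel_right _ _ ht]
  have hBA : (A⁻¹ * B)ᵀ = A⁻¹ * B := by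
    rw [transpose_mul, transpose_nonsing_inv, ← nonsing_inv_mul_cancel_left _ (Bᵀ * Aᵀ⁻¹) ht,
      ← mul_assoc A, hAB, mul_nonsing_inv_cancel_right _ _ hAT]
  have hSinv : S⁻¹ᵀ = S⁻¹ := by rw [transpose_nonsing_inv, hS.eq]
  have hRinv : R⁻¹ᵀ = R⁻¹ := by rw [transpose_nonsing_inv, hR.eq]
  let F : ℕ → Matrix (Fin d) (Fin d) ℝ
    | 1 => -R⁻¹ + A⁻¹ * B
    | 2 => R
    | 3 => S - R⁻¹
    | 4 => -S⁻¹
    | 5 => S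
    | 6 => C * A⁻¹
    | 7 => -(t • 1)
    | _ => 0
  have hmerge : (fromBlocks 1 (-R⁻¹) 0 1 * fromBlocks 1 (A⁻¹ * B) 0 1 :
      Matrix (Fin d ⊕ Fin d) (Fin d ⊕ Fin d) ℝ) = fromBlocks 1 (-R⁻¹ + A⁻¹ * B) 0 1 := by
    simp [fromBlocks_multiply, add_comm]
  refine ⟨F, ?_, ?_, ?_⟩
  · intro i
    match i with
    | 1 => simp only [F, transpose_add, transpose_neg, hRinv, hBA]
    | 2 => exact hR
    | 3 => simp only [F, transpose_sub, hRinv, hS.eq]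
    | 4 => simp only [F, transpose_neg, hSinv]
    | 5 => exact hS
    | 6 => exact hCA
    | 7 => simp [F]
    | 0 => exact transpose_zero
    | _ + 8 => exact transpose_zero
  · intro i hi
    match i, hi with
    | _ + 8, _ => rfl
  · rw [hunshift, fromBlocks_symplectic_eq_LDU ht hAC hAD, hATinv]
    nth_rw 2 [hSR]
    rw [fromBlocks_diagonal_eq_triangular_prod hSdet hRdet]
    simp only [mul_assoc, hmerge]
    simp [altProd, Pfac, F]

/-- **For every `n ≥ 9`, `Lₙ = SP`.** A real `2d × 2d` matrix is symplectic if and only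
if it is an alternating product of `n` unit upper and lower triangular symplectic
matrices with symmetric blocks. -/
theorem L_eq_SP (d n : ℕ) (hn : 9 ≤ n) (H : Matrix (Fin d ⊕ Fin d) (Fin d ⊕ Fin d) ℝ) :
    Hᵀ * Jmat d * H = Jmat d ↔
      ∃ S : ℕ → Matrix (Fin d) (Fin d) ℝ, (∀ i, (S i)ᵀ = S i) ∧ H = altProd d n S := by
  rw [← mem_symplecticGroup_iff_Jmat]
  constructor
  · intro hH
    obtain ⟨S, hS, hS0, rfl⟩ := exists_eq_altProd_seven hH
    exact ⟨S, hS, (altProd_eq_of_eq_zero (by omega) hS0).symm⟩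
  · rintro ⟨S, hS, rfl⟩
    exact altProd_mem_symplecticGroup hS n
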